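/- If γ: S^1 × S^1 → S^2 is a smooth map of the torus to the 2-sphere such that for each t ∈ S^1 the curve s ↦ γ(t,s) is an immersion, and the family {γ_t} never undergoes a Type 1 Reidemeister move (i.e., every curve in the family is an immersion), then the degree of γ is zero. -/

import Mathlib

noncomputable section

/-- First partial derivative (in the torus parameter `t`) of a family of curves. -/
def pderiv1 (f : ℝ × ℝ → EuclideanSpace ℝ (Fin 3)) (q : ℝ × ℝ) : EuclideanSpace ℝ (Fin 3) :=
  deriv (fun u => f (u, q.2)) q.1

/-- Second partial derivative (in the curve parameter `s`) of a family of curves. -/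
def pderiv2 (f : ℝ × ℝ → EuclideanSpace ℝ (Fin 3)) (q : ℝ × ℝ) : EuclideanSpace ℝ (Fin 3) :=
  deriv (fun u => f (q.1, u)) q.2

/-- The determinant of the frame `(f q, ∂₁ f q, ∂₂ f q)` in `ℝ³`; its sign is the local
degree of the map at a regular preimage `q` (using the outward normal orientation of `S²`). -/
def frameDet (f : ℝ × ℝ → EuclideanSpace ℝ (Fin 3)) (q : ℝ × ℝ) : ℝ :=
  Matrix.det (Matrix.of ![fun j => f q j, fun j => pderiv1 f q j, fun j => pderiv2 f q j])

/-- `f : T² → S²` (written as a doubly `1`-periodic map `ℝ × ℝ → S² ⊆ ℝ³`) has topological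
degree `d`: there is a regular value `x` whose (finitely many) preimages in a fundamental
domain are all transverse, and the signed count of these preimages equals `d`. -/
def HasDegree (f : ℝ × ℝ → EuclideanSpace ℝ (Fin 3)) (d : ℤ) : Prop :=
  ∃ (x : EuclideanSpace ℝ (Fin 3)) (S : Finset (ℝ × ℝ)), ‖x‖ = 1 ∧
    (↑S ⊆ Set.Ico (0:ℝ) 1 ×ˢ Set.Ico (0:ℝ) 1) ∧
    (∀ q ∈ Set.Ico (0:ℝ) 1 ×ˢ Set.Ico (0:ℝ) 1, (f q = x ↔ q ∈ S)) ∧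
    (∀ q ∈ S, frameDet f q ≠ 0) ∧
    d = ∑ q ∈ S, (if 0 < frameDet f q then (1:ℤ) else -1)

open Set MeasureTheory

/-- The Jacobian determinant `∂₁p ∂₂q - ∂₂p ∂₁q` of a pair of functions on the plane. -/
def jacobian (p q : ℝ × ℝ → ℝ) (z : ℝ × ℝ) : ℝ :=
  fderiv ℝ p z (1, 0) * fderiv ℝ q z (0, 1) - fderiv ℝ p z (0, 1) * fderiv ℝ q z (1, 0)

/-- A function on the plane that is `1`-periodic in both variables. -/
def DoublyPeriodic {E : Type*} (p : ℝ × ℝ → E) : Prop :=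
  ∀ s t : ℝ, p (s + 1, t) = p (s, t) ∧ p (s, t + 1) = p (s, t)

theorem DoublyPeriodic.fderiv_apply {p : ℝ × ℝ → ℝ} (hp : DoublyPeriodic p) (v : ℝ × ℝ) :
    DoublyPeriodic fun z => fderiv ℝ p z v := by
  intro s t
  have h1 : (fun z : ℝ × ℝ => p (z + (1, 0))) = p := by
    ext ⟨a, b⟩; simpa using (hp a b).1
  have h2 : (fun z : ℝ × ℝ => p (z + (0, 1))) = p := by
    ext ⟨a, b⟩; simpa using (hp a b).2
  constructor
  · have := fderiv_comp_add_right (𝕜 := ℝ) (f := p) (x := (s, t)) (1, 0)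
    rw [h1] at this
    simp [this]
  · have := fderiv_comp_add_right (𝕜 := ℝ) (f := p) (x := (s, t)) (0, 1)
    rw [h2] at this
    simp [this]

theorem continuous_jacobian {p q : ℝ × ℝ → ℝ} (hp : ContDiff ℝ 1 p) (hq : ContDiff ℝ 1 q) :
    Continuous (jacobian p q) := by
  have h1 := hp.continuous_fderiv one_ne_zero
  have h2 := hq.continuous_fderiv one_ne_zero
  unfold jacobian
  fun_prop

/-- By Stokes' theorem the Jacobian of doubly periodic functions has integral zero. -/
theorem integral_jacobian_eq_zero {p q : ℝ × ℝ → ℝ} (hp : ContDiff ℝ 1 p) (hq : ContDiff ℝ 2 q)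
    (hp' : DoublyPeriodic p) (hq' : DoublyPeriodic q) :
    ∫ z in Icc (0 : ℝ × ℝ) 1, jacobian p q z = 0 := by
  have hq1 : ContDiff ℝ 1 (fderiv ℝ q) := hq.fderiv_right (by norm_num)
  have hdq : ∀ v z, HasFDerivAt (fun z => fderiv ℝ q z v)
      ((ContinuousLinearMap.apply ℝ ℝ v).comp (fderiv ℝ (fderiv ℝ q) z)) z := fun v z =>
    (ContinuousLinearMap.apply ℝ ℝ v).hasFDerivAt.comp z
      ((hq1.differentiable one_ne_zero) z).hasFDerivAt
  have hdp : ∀ z, HasFDerivAt p (fderiv ℝ p z) z := fun z =>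
    ((hp.differentiable one_ne_zero) z).hasFDerivAt
  have hF := fun z => (hdp z).mul (hdq (0, 1) z)
  have hG := fun z => ((hdp z).mul (hdq (1, 0) z)).neg
  have hsymm : ∀ z, fderiv ℝ (fderiv ℝ q) z (1, 0) (0, 1) = fderiv ℝ (fderiv ℝ q) z (0, 1) (1, 0) :=
    fun z => (hq.contDiffAt.isSymmSndFDerivAt (by simp)) _ _
  have key : ∀ z, (p z • (ContinuousLinearMap.apply ℝ ℝ ((0 : ℝ), (1 : ℝ))).comp
        (fderiv ℝ (fderiv ℝ q) z) + fderiv ℝ q z (0, 1) • fderiv ℝ p z) (1, 0) +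
      (-(p z • (ContinuousLinearMap.apply ℝ ℝ ((1 : ℝ), (0 : ℝ))).comp
        (fderiv ℝ (fderiv ℝ q) z) + fderiv ℝ q z (1, 0) • fderiv ℝ p z)) (0, 1) =
      jacobian p q z := by
    intro z
    simp [jacobian, hsymm]
    ring
  have hint : IntegrableOn (jacobian p q) (Icc (0 : ℝ × ℝ) 1) :=
    (continuous_jacobian hp (hq.of_le (by norm_num))).continuousOn.integrableOn_compact
      isCompact_Icc
  have := integral_divergence_prod_Icc_of_hasFDerivAt_of_le _ _ _ _ (0 : ℝ × ℝ) 1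
    (by simp) (fun z _ => (hF z).continuousAt.continuousWithinAt)
    (fun z _ => (hG z).continuousAt.continuousWithinAt)
    (fun z _ => hF z) (fun z _ => hG z) (by simpa only [key] using hint)
  simp only [key] at this
  rw [this]
  have e1 : ∀ y, p (1, y) = p (0, y) := fun y => by simpa using (hp' 0 y).1
  have e2 : ∀ x, p (x, 1) = p (x, 0) := fun x => by simpa using (hp' x 0).2
  have e3 : ∀ v y, fderiv ℝ q (1, y) v = fderiv ℝ q (0, y) v :=
    fun v y => by simpa using (hq'.fderiv_apply v 0 y).1
  have e4 : ∀ v x, fderiv ℝ q (x, 1) v = fderiv ℝ q (x, 0) v :=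
    fun v x => by simpa using (hq'.fderiv_apply v x 0).2
  simp [e1, e2, e3, e4]

theorem exists_cap_profile {a : ℝ} (ha : 0 < a) (ha1 : a < 1) :
    ∃ b : ℝ → ℝ, ContDiff ℝ 1 b ∧
      (∀ h ≤ a, 1 - (1 - h ^ 2) * deriv b h + 2 * h * b h = 0) ∧
      (∀ h, a < h → h ≤ 1 → 0 < 1 - (1 - h ^ 2) * deriv b h + 2 * h * b h) := by
  have hne : ∀ u, (1 - min u a) ≠ 0 := fun u => by have := min_le_right u a; linarith
  have hcont : Continuous fun u : ℝ => ((1 - min u a) ^ 2)⁻¹ :=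
    (by fun_prop : Continuous fun u : ℝ => (1 - min u a) ^ 2).inv₀ fun u => pow_ne_zero _ (hne u)
  set b : ℝ → ℝ := fun h => (1 - a)⁻¹ + ∫ u in a..h, ((1 - min u a) ^ 2)⁻¹ with hb
  have hd : ∀ h, HasDerivAt b (((1 - min h a) ^ 2)⁻¹) h := fun h =>
    (intervalIntegral.integral_hasDerivAt_right (hcont.intervalIntegrable _ _)
      hcont.aestronglyMeasurable.stronglyMeasurableAtFilter hcont.continuousAt).const_add _
  have hderiv : deriv b = fun h => ((1 - min h a) ^ 2)⁻¹ := funext fun h => (hd h).deriv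
  refine ⟨b, ?_, ?_, ?_⟩
  · rw [contDiff_one_iff_deriv, hderiv]
    exact ⟨fun h => (hd h).differentiableAt, hcont⟩
  · intro h hh
    have hbh : b h = (1 - h)⁻¹ := by
      have : ∫ u in a..h, ((1 - min u a) ^ 2)⁻¹ = (1 - h)⁻¹ - (1 - a)⁻¹ := by
        refine intervalIntegral.integral_eq_sub_of_hasDerivAt (f := fun u => (1 - u)⁻¹) ?_
          (hcont.intervalIntegrable _ _)
        intro u hu
        rw [uIcc_of_ge hh] at hu
        have h1 : (1 - u) ≠ 0 := by linarith [hu.2]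
        rw [min_eq_left hu.2]
        simpa using ((hasDerivAt_id' u).const_sub 1).fun_inv h1
      rw [show b h = (1 - a)⁻¹ + ∫ u in a..h, ((1 - min u a) ^ 2)⁻¹ from rfl, this]
      ring
    have h1 : (1 - h) ≠ 0 := by linarith
    simp only [hderiv]
    rw [hbh, min_eq_left hh]
    field_simp
    ring
  · intro h hh h1
    have hbh : b h = (1 - a)⁻¹ + (h - a) * ((1 - a) ^ 2)⁻¹ := by
      have : ∫ u in a..h, ((1 - min u a) ^ 2)⁻¹ = ∫ u in a..h, ((1 - a) ^ 2)⁻¹ := by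
        refine intervalIntegral.integral_congr fun u hu => ?_
        rw [uIcc_of_le hh.le] at hu
        rw [min_eq_right hu.1]
      rw [show b h = (1 - a)⁻¹ + ∫ u in a..h, ((1 - min u a) ^ 2)⁻¹ from rfl, this]
      simp
    simp only [hderiv]
    rw [hbh, min_eq_right hh.le]
    have h2 : 0 < 1 - a := by linarith
    field_simp
    nlinarith [mul_pos (sub_pos.2 hh) h2, mul_pos (sub_pos.2 hh) ha,
      mul_pos (sub_pos.2 hh) (ha.trans hh)]

/-- A tangent vector to the unit sphere decomposes along an orthonormal frame. -/
theorem tangent_decomposition {x y z a b c u v w : ℝ} (hs : x ^ 2 + y ^ 2 + z ^ 2 = 1)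
    (he : a ^ 2 + b ^ 2 + c ^ 2 = 1) (ho : x * a + y * b + z * c = 0)
    (ht : x * u + y * v + z * w = 0) :
    ∃ p r, u = p * a + r * (y * c - z * b) ∧ v = p * b + r * (z * a - x * c) ∧
      w = p * c + r * (x * b - y * a) := by
  refine ⟨u * a + v * b + w * c,
    u * (y * c - z * b) + v * (z * a - x * c) + w * (x * b - y * a), ?_, ?_, ?_⟩
  all_goals grind

theorem orthonormal_derivative {x y z a b c u v w u' v' w' : ℝ} (hs : x ^ 2 + y ^ 2 + z ^ 2 = 1)
    (he : a ^ 2 + b ^ 2 + c ^ 2 = 1) (ho : x * a + y * b + z * c = 0)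
    (ht : x * u + y * v + z * w = 0) (ht' : a * u' + b * v' + c * w' = 0)
    (hm : x * u' + y * v' + z * w' + (u * a + v * b + w * c) = 0) :
    ∃ p r q, u = p * a + r * (y * c - z * b) ∧ v = p * b + r * (z * a - x * c) ∧
      w = p * c + r * (x * b - y * a) ∧ u' = -p * x + q * (y * c - z * b) ∧
      v' = -p * y + q * (z * a - x * c) ∧ w' = -p * z + q * (x * b - y * a)  := by
  obtain ⟨p, r, rfl, rfl, rfl⟩ := tangent_decomposition hs he ho ht
  obtain ⟨p', q, rfl, rfl, rfl⟩ := tangent_decomposition (x := a) (y := b) (z := c)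
    (a := x) (b := y) (c := z) he hs (by linarith) ht'
  have : p' = -p := by grind
  subst this
  exact ⟨p, r, -q, rfl, rfl, rfl, by ring, by ring, by ring⟩

theorem frame_identity {x y z a b c u₁ v₁ w₁ a₁ b₁ c₁ u₂ v₂ w₂ a₂ b₂ c₂ : ℝ}
    (hs : x ^ 2 + y ^ 2 + z ^ 2 = 1)
    (he : a ^ 2 + b ^ 2 + c ^ 2 = 1) (ho : x * a + y * b + z * c = 0)
    (ht₁ : x * u₁ + y * v₁ + z * w₁ = 0) (ht₁' : a * a₁ + b * b₁ + c * c₁ = 0)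
    (hm₁ : x * a₁ + y * b₁ + z * c₁ + (u₁ * a + v₁ * b + w₁ * c) = 0)
    (ht₂ : x * u₂ + y * v₂ + z * w₂ = 0) (ht₂' : a * a₂ + b * b₂ + c * c₂ = 0)
    (hm₂ : x * a₂ + y * b₂ + z * c₂ + (u₂ * a + v₂ * b + w₂ * c) = 0) :
    (v₁ * c + y * c₁ - (w₁ * b + z * b₁)) * a₂ - (v₂ * c + y * c₂ - (w₂ * b + z * b₂)) * a₁
    + ((w₁ * a + z * a₁ - (u₁ * c + x * c₁)) * b₂ - (w₂ * a + z * a₂ - (u₂ * c + x * c₂)) * b₁)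
    + ((u₁ * b + x * b₁ - (v₁ * a + y * a₁)) * c₂ - (u₂ * b + x * b₂ - (v₂ * a + y * a₂)) * c₁)
    = -(x * (v₁ * w₂ - v₂ * w₁) + y * (w₁ * u₂ - w₂ * u₁) + z * (u₁ * v₂ - u₂ * v₁)) := by
  obtain ⟨p₁, r₁, q₁, rfl, rfl, rfl, rfl, rfl, rfl⟩ := orthonormal_derivative hs he ho ht₁ ht₁' hm₁
  obtain ⟨p₂, r₂, q₂, rfl, rfl, rfl, rfl, rfl, rfl⟩ := orthonormal_derivative hs he ho ht₂ ht₂' hm₂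
  clear ht₁ ht₁' hm₁ ht₂ ht₂' hm₂
  obtain ⟨l, hl⟩ : ∃ l, l = y * c - z * b := ⟨_, rfl⟩
  obtain ⟨m, hm⟩ : ∃ m, m = z * a - x * c := ⟨_, rfl⟩
  obtain ⟨n, hn⟩ : ∃ n, n = x * b - y * a := ⟨_, rfl⟩
  have k1 : b * n - c * m = x := by grind
  have k2 : c * l - a * n = y := by grind
  have k3 : a * m - b * l = z := by grind
  have k4 : y * n - z * m = -a := by grind
  have k5 : z * l - x * n = -b := by grind
  have k6 : x * m - y * l = -c := by grind
  have k7 : x * l + y * m + z * n = 0 := by grind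
  have k8 : a * l + b * m + c * n = 0 := by grind
  have k9 : l ^ 2 + m ^ 2 + n ^ 2 = 1 := by grind
  rw [← hl, ← hm, ← hn]
  have N : ∀ p r q : ℝ, (p * b + r * m) * c + y * (-p * z + q * n)
     - ((p * c + r * n) * b + z * (-p * y + q * m)) = - r * x - q * a := by
    intro p r q
    linear_combination -r * k1 + q * k4
  have N' : ∀ p r q : ℝ, (p * c + r * n) * a + z * (-p * x + q * l)
     - ((p * a + r * l) * c + x * (-p * z + q * n)) = - r * y - q * b := by
    intro p r q
    linear_combination -r * k2 + q * k5
  have N'' : ∀ p r q : ℝ, (p * a + r * l) * b + x * (-p * y + q * m)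
     - ((p * b + r * m) * a + y * (-p * x + q * l)) = - r * z - q * c := by
    intro p r q
    linear_combination -r * k3 + q * k6
  simp only [N, N', N'']
  have L : (- r₁ * x - q₁ * a) * (-p₂ * x + q₂ * l) - (- r₂ * x - q₂ * a) * (-p₁ * x + q₁ * l)
    + ((- r₁ * y - q₁ * b) * (-p₂ * y + q₂ * m) - (- r₂ * y - q₂ * b) * (-p₁ * y + q₁ * m))
    + ((- r₁ * z - q₁ * c) * (-p₂ * z + q₂ * n) - (- r₂ * z - q₂ * c) * (-p₁ * z + q₁ * n))
    = r₁ * p₂ - r₂ * p₁ := by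
    linear_combination (r₁ * p₂ - r₂ * p₁) * hs + (q₁ * p₂ - q₂ * p₁) * ho +
      (r₂ * q₁ - r₁ * q₂) * k7
  rw [L]
  linear_combination (p₁ * r₂ - p₂ * r₁) * (x * k1 + y * k2 + z * k3 + hs)

theorem cross_identity {x y z u₁ v₁ w₁ u₂ v₂ w₂ : ℝ} (hs : x ^ 2 + y ^ 2 + z ^ 2 = 1)
    (ht₁ : x * u₁ + y * v₁ + z * w₁ = 0) (ht₂ : x * u₂ + y * v₂ + z * w₂ = 0) :
    z * (x * (v₁ * w₂ - v₂ * w₁) + y * (w₁ * u₂ - w₂ * u₁) + z * (u₁ * v₂ - u₂ * v₁))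
     = u₁ * v₂ - u₂ * v₁ := by
  linear_combination (u₁ * v₂ - u₂ * v₁) * hs + (x * v₁ - y * u₁) * ht₂ - (x * v₂ - y * u₂) * ht₁

theorem DoublyPeriodic.comp₂ {p q : ℝ × ℝ → ℝ} (hp : DoublyPeriodic p) (hq : DoublyPeriodic q)
    (φ : ℝ → ℝ → ℝ) : DoublyPeriodic fun z => φ (p z) (q z) := fun s t => by
  simp only [hp s t, hq s t, and_self]

theorem jacobian_mul_left {p q r : ℝ × ℝ → ℝ} {z : ℝ × ℝ} (hp : DifferentiableAt ℝ p z)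
    (hq : DifferentiableAt ℝ q z) :
    jacobian (fun w => p w * q w) r z = p z * jacobian q r z + q z * jacobian p r z := by
  simp only [jacobian, fderiv_fun_mul hp hq, FunLike.coe_add, FunLike.coe_smul,
    Pi.add_apply, Pi.smul_apply, smul_eq_mul]
  ring

theorem jacobian_sub_left {p q r : ℝ × ℝ → ℝ} {z : ℝ × ℝ} (hp : DifferentiableAt ℝ p z)
    (hq : DifferentiableAt ℝ q z) :
    jacobian (fun w => p w - q w) r z = jacobian p r z - jacobian q r z := by
  simp only [jacobian, fderiv_fun_sub hp hq, FunLike.coe_sub, Pi.sub_apply]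
  ring

theorem jacobian_comp_left {b : ℝ → ℝ} {p q : ℝ × ℝ → ℝ} {z : ℝ × ℝ}
    (hb : DifferentiableAt ℝ b (p z)) (hp : DifferentiableAt ℝ p z) :
    jacobian (fun w => b (p w)) q z = deriv b (p z) * jacobian p q z := by
  have : fderiv ℝ (fun w => b (p w)) z = deriv b (p z) • fderiv ℝ p z :=
    (hb.hasDerivAt.comp_hasFDerivAt z hp.hasFDerivAt).fderiv
  simp only [jacobian, this, FunLike.coe_smul, Pi.smul_apply, smul_eq_mul]
  ring

/-- The pull-back of the area form of the unit sphere under `(X, Y, Z)`. -/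
def areaPullback (X Y Z : ℝ × ℝ → ℝ) (z : ℝ × ℝ) : ℝ :=
  X z * jacobian Y Z z + Y z * jacobian Z X z + Z z * jacobian X Y z

theorem fderiv_inner_eq_zero {X Y Z A B C : ℝ × ℝ → ℝ} {k : ℝ} (hX : Differentiable ℝ X)
    (hY : Differentiable ℝ Y) (hZ : Differentiable ℝ Z) (hA : Differentiable ℝ A)
    (hB : Differentiable ℝ B) (hC : Differentiable ℝ C)
    (h : ∀ z, X z * A z + Y z * B z + Z z * C z = k) (z v : ℝ × ℝ) :
    X z * fderiv ℝ A z v + Y z * fderiv ℝ B z v + Z z * fderiv ℝ C z v +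
      (fderiv ℝ X z v * A z + fderiv ℝ Y z v * B z + fderiv ℝ Z z v * C z) = 0 := by
  have h1 : fderiv ℝ (fun z => X z * A z + Y z * B z + Z z * C z) z = 0 := by
    simp [funext h]
  rw [fderiv_fun_add (by fun_prop) (by fun_prop), fderiv_fun_add (by fun_prop) (by fun_prop),
    fderiv_fun_mul (by fun_prop) (by fun_prop), fderiv_fun_mul (by fun_prop) (by fun_prop),
    fderiv_fun_mul (by fun_prop) (by fun_prop)] at h1
  have h2 := congrArg (fun l => l v) h1
  simp only [FunLike.coe_add, FunLike.coe_smul, Pi.add_apply, Pi.smul_apply, smul_eq_mul,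
    FunLike.coe_zero, Pi.zero_apply] at h2
  linarith

section Sphere

variable {X Y Z : ℝ × ℝ → ℝ}

theorem fderiv_sphere (hX : Differentiable ℝ X) (hY : Differentiable ℝ Y) (hZ : Differentiable ℝ Z)
    (hs : ∀ z, X z ^ 2 + Y z ^ 2 + Z z ^ 2 = 1) (z v : ℝ × ℝ) :
    X z * fderiv ℝ X z v + Y z * fderiv ℝ Y z v + Z z * fderiv ℝ Z z v = 0 := by
  have := fderiv_inner_eq_zero hX hY hZ hX hY hZ (k := 1) (fun z => by linarith [hs z]) z v
  linarith

theorem mul_areaPullback (hX : Differentiable ℝ X) (hY : Differentiable ℝ Y)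
    (hZ : Differentiable ℝ Z) (hs : ∀ z, X z ^ 2 + Y z ^ 2 + Z z ^ 2 = 1) (z : ℝ × ℝ) :
    Z z * areaPullback X Y Z z = jacobian X Y z := by
  have := cross_identity (hs z) (fderiv_sphere hX hY hZ hs z (1, 0))
    (fderiv_sphere hX hY hZ hs z (0, 1))
  simp only [areaPullback, jacobian]
  linarith

theorem areaPullback_rotate (X Y Z : ℝ × ℝ → ℝ) (z : ℝ × ℝ) :
    areaPullback Y Z X z = areaPullback X Y Z z := by
  simp only [areaPullback]
  ring

theorem integral_weighted_areaPullback_eq_zero (hX : ContDiff ℝ 3 X)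
    (hY : ContDiff ℝ 3 Y) (hZ : ContDiff ℝ 3 Z) (hs : ∀ z, X z ^ 2 + Y z ^ 2 + Z z ^ 2 = 1)
    (hX' : DoublyPeriodic X) (hY' : DoublyPeriodic Y) (hZ' : DoublyPeriodic Z)
    (himm : ∀ z, fderiv ℝ X z (0, 1) ^ 2 + fderiv ℝ Y z (0, 1) ^ 2 + fderiv ℝ Z z (0, 1) ^ 2 ≠ 0)
    {b : ℝ → ℝ} (hb : ContDiff ℝ 1 b) :
    ∫ z in Icc (0 : ℝ × ℝ) 1, (1 - (1 - Z z ^ 2) * deriv b (Z z) + 2 * Z z * b (Z z)) *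
      areaPullback X Y Z z = 0 := by
  set N : ℝ × ℝ → ℝ := fun z =>
    √(fderiv ℝ X z (0, 1) ^ 2 + fderiv ℝ Y z (0, 1) ^ 2 + fderiv ℝ Z z (0, 1) ^ 2) with hN
  have hN2 : ∀ z, N z ^ 2 =
      fderiv ℝ X z (0, 1) ^ 2 + fderiv ℝ Y z (0, 1) ^ 2 + fderiv ℝ Z z (0, 1) ^ 2 :=
    fun z => Real.sq_sqrt (by positivity)
  have hN0 : ∀ z, N z ≠ 0 := fun z h => himm z (by rw [← hN2, h]; ring)
  have hd : ∀ {p : ℝ × ℝ → ℝ}, ContDiff ℝ 3 p → ContDiff ℝ 2 fun z => fderiv ℝ p z (0, 1) :=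
    fun hp => (hp.fderiv_right (m := 2) (by norm_num)).clm_apply contDiff_const
  have hNc : ContDiff ℝ 2 N :=
    ((((hd hX).pow 2).add ((hd hY).pow 2)).add ((hd hZ).pow 2)).sqrt himm
  have hNp : DoublyPeriodic N := fun s t => by
    simp only [hN, hX'.fderiv_apply (0, 1) s t, hY'.fderiv_apply (0, 1) s t,
      hZ'.fderiv_apply (0, 1) s t, and_self]
  set a : ℝ × ℝ → ℝ := fun z => fderiv ℝ X z (0, 1) / N z with ha
  set e : ℝ × ℝ → ℝ := fun z => fderiv ℝ Y z (0, 1) / N z with he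
  set c : ℝ × ℝ → ℝ := fun z => fderiv ℝ Z z (0, 1) / N z with hc
  have hac : ContDiff ℝ 2 a := (hd hX).div hNc hN0
  have hec : ContDiff ℝ 2 e := (hd hY).div hNc hN0
  have hcc : ContDiff ℝ 2 c := (hd hZ).div hNc hN0
  have hap : DoublyPeriodic a := (hX'.fderiv_apply (0, 1)).comp₂ hNp (· / ·)
  have hep : DoublyPeriodic e := (hY'.fderiv_apply (0, 1)).comp₂ hNp (· / ·)
  have hcp : DoublyPeriodic c := (hZ'.fderiv_apply (0, 1)).comp₂ hNp (· / ·)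
  have dX := hX.differentiable (by norm_num)
  have dY := hY.differentiable (by norm_num)
  have dZ := hZ.differentiable (by norm_num)
  have da := hac.differentiable (by norm_num)
  have de := hec.differentiable (by norm_num)
  have dc := hcc.differentiable (by norm_num)
  have db := hb.differentiable one_ne_zero
  have hunit : ∀ z, a z ^ 2 + e z ^ 2 + c z ^ 2 = 1 := fun z => by
    simp only [ha, he, hc, div_pow, ← add_div, ← hN2]
    exact div_self (pow_ne_zero 2 (hN0 z))
  have horth : ∀ z, X z * a z + Y z * e z + Z z * c z = 0 := fun z => by
    have := fderiv_sphere dX dY dZ hs z (0, 1)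
    simp only [ha, he, hc, mul_div_assoc', ← add_div, this, zero_div]
  have cX := hX.of_le (show (1 : WithTop ℕ∞) ≤ 3 by norm_num)
  have cY := hY.of_le (show (1 : WithTop ℕ∞) ≤ 3 by norm_num)
  have cZ := hZ.of_le (show (1 : WithTop ℕ∞) ≤ 3 by norm_num)
  have ca := hac.of_le (show (1 : WithTop ℕ∞) ≤ 2 by norm_num)
  have ce := hec.of_le (show (1 : WithTop ℕ∞) ≤ 2 by norm_num)
  have cc := hcc.of_le (show (1 : WithTop ℕ∞) ≤ 2 by norm_num)
  have hbZ : ContDiff ℝ 1 fun z => b (Z z) := hb.comp cZ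
  have hbZp : DoublyPeriodic fun z => b (Z z) := hZ'.comp₂ hZ' fun u _ => b u
  have cn₁ : ContDiff ℝ 1 fun z => Y z * c z - Z z * e z := (cY.mul cc).sub (cZ.mul ce)
  have cn₂ : ContDiff ℝ 1 fun z => Z z * a z - X z * c z := (cZ.mul ca).sub (cX.mul cc)
  have cn₃ : ContDiff ℝ 1 fun z => X z * e z - Y z * a z := (cX.mul ce).sub (cY.mul ca)
  have cβ₁ : ContDiff ℝ 1 fun z => b (Z z) * X z := hbZ.mul cX
  have cβ₂ : ContDiff ℝ 1 fun z => b (Z z) * Y z := hbZ.mul cY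
  have cross_periodic : ∀ {p q r s : ℝ × ℝ → ℝ}, DoublyPeriodic p → DoublyPeriodic q →
      DoublyPeriodic r → DoublyPeriodic s → DoublyPeriodic fun z => p z * q z - r z * s z :=
    fun hp hq hr hs => (hp.comp₂ hq (· * ·)).comp₂ (hr.comp₂ hs (· * ·)) (· - ·)
  have I₁ := integral_jacobian_eq_zero cn₁ hac (cross_periodic hY' hcp hZ' hep) hap
  have I₂ := integral_jacobian_eq_zero cn₂ hec (cross_periodic hZ' hap hX' hcp) hep
  have I₃ := integral_jacobian_eq_zero cn₃ hcc (cross_periodic hX' hep hY' hap) hcp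
  have I₄ := integral_jacobian_eq_zero cβ₁ (hY.of_le (by norm_num)) (hbZp.comp₂ hX' (· * ·)) hY'
  have I₅ := integral_jacobian_eq_zero cβ₂ (hX.of_le (by norm_num)) (hbZp.comp₂ hY' (· * ·)) hX'
  have int : ∀ {p q : ℝ × ℝ → ℝ}, ContDiff ℝ 1 p → ContDiff ℝ 1 q →
      IntegrableOn (jacobian p q) (Icc (0 : ℝ × ℝ) 1) := fun hp hq =>
    (continuous_jacobian hp hq).continuousOn.integrableOn_compact isCompact_Icc
  have key : ∀ z, (1 - (1 - Z z ^ 2) * deriv b (Z z) + 2 * Z z * b (Z z)) * areaPullback X Y Z z =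
      jacobian (fun z => b (Z z) * X z) Y z - jacobian (fun z => b (Z z) * Y z) X z -
      (jacobian (fun z => Y z * c z - Z z * e z) a z + jacobian (fun z => Z z * a z - X z * c z) e z
        + jacobian (fun z => X z * e z - Y z * a z) c z) := by
    intro z
    have hfr := frame_identity (hs z) (hunit z) (horth z)
      (fderiv_sphere dX dY dZ hs z (1, 0)) (fderiv_sphere da de dc hunit z (1, 0))
      (fderiv_inner_eq_zero dX dY dZ da de dc horth z (1, 0))
      (fderiv_sphere dX dY dZ hs z (0, 1)) (fderiv_sphere da de dc hunit z (0, 1))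
      (fderiv_inner_eq_zero dX dY dZ da de dc horth z (0, 1))
    have j₃ := mul_areaPullback dX dY dZ hs z
    have j₂ := mul_areaPullback dZ dX dY (fun z => by linarith [hs z]) z
    rw [← areaPullback_rotate] at j₂
    have j₁ := mul_areaPullback dY dZ dX (fun z => by linarith [hs z]) z
    rw [areaPullback_rotate] at j₁
    have dbZ : DifferentiableAt ℝ (fun z => b (Z z)) z := db.comp dZ z
    have e₁ : jacobian (fun z => b (Z z) * X z) Y z - jacobian (fun z => b (Z z) * Y z) X z =
        2 * b (Z z) * jacobian X Y z - deriv b (Z z) * (X z * jacobian Y Z z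
          + Y z * jacobian Z X z) := by
      rw [jacobian_mul_left dbZ (dX z), jacobian_mul_left dbZ (dY z),
        jacobian_comp_left (db _) (dZ z), jacobian_comp_left (db _) (dZ z)]
      simp only [jacobian]
      ring
    have e₂ : jacobian (fun z => Y z * c z - Z z * e z) a z
        + jacobian (fun z => Z z * a z - X z * c z) e z
        + jacobian (fun z => X z * e z - Y z * a z) c z = - areaPullback X Y Z z := by
      rw [jacobian_sub_left (by fun_prop) (by fun_prop),
        jacobian_sub_left (by fun_prop) (by fun_prop),
        jacobian_sub_left (by fun_prop) (by fun_prop),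
        jacobian_mul_left (by fun_prop) (by fun_prop),
        jacobian_mul_left (by fun_prop) (by fun_prop),
        jacobian_mul_left (by fun_prop) (by fun_prop),
        jacobian_mul_left (by fun_prop) (by fun_prop),
        jacobian_mul_left (by fun_prop) (by fun_prop),
        jacobian_mul_left (by fun_prop) (by fun_prop)]
      simp only [jacobian, areaPullback]
      linear_combination hfr
    rw [e₁, e₂, ← j₁, ← j₂, ← j₃]
    linear_combination deriv b (Z z) * areaPullback X Y Z z * hs z
  rw [integral_congr_ae (g := (jacobian (fun z => b (Z z) * X z) Y -
      jacobian (fun z => b (Z z) * Y z) X) - (jacobian (fun z => Y z * c z - Z z * e z) a +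
      jacobian (fun z => Z z * a z - X z * c z) e + jacobian (fun z => X z * e z - Y z * a z) c))
      (.of_forall key),
    integral_sub' ((int cβ₁ cY).sub (int cβ₂ cX))
      (((int cn₁ ca).add (int cn₂ ce)).add (int cn₃ cc)),
    integral_sub' (int cβ₁ cY) (int cβ₂ cX),
    integral_add' ((int cn₁ ca).add (int cn₂ ce)) (int cn₃ cc),
    integral_add' (int cn₁ ca) (int cn₂ ce), I₁, I₂, I₃, I₄, I₅]
  simp

end Sphere

section Localization

open Filter Topology

theorem det_prod_fderiv (p q : ℝ × ℝ → ℝ) (z : ℝ × ℝ) :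
    ((fderiv ℝ p z).prod (fderiv ℝ q z)).det = jacobian p q z := by
  have := LinearMap.det_toMatrix (Module.Basis.finTwoProd ℝ)
    (((fderiv ℝ p z).prod (fderiv ℝ q z) : ℝ × ℝ →L[ℝ] ℝ × ℝ) : ℝ × ℝ →ₗ[ℝ] ℝ × ℝ)
  rw [ContinuousLinearMap.det, ← this, Matrix.det_fin_two]
  simp [LinearMap.toMatrix_apply, jacobian]

/-- The weight of the cap `a < Z` of the sphere, in the chart given by orthogonal projection. -/
def capDensity (ρ : ℝ → ℝ) (a : ℝ) (y : ℝ × ℝ) : ℝ :=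
  ρ √(1 - (y.1 ^ 2 + y.2 ^ 2)) / max √(1 - (y.1 ^ 2 + y.2 ^ 2)) a

theorem capDensity_eq_zero {ρ : ℝ → ℝ} {a : ℝ} (ha : 0 < a) (hρ : ∀ h ≤ a, ρ h = 0) {y : ℝ × ℝ}
    (hy : 1 - a ^ 2 ≤ y.1 ^ 2 + y.2 ^ 2) : capDensity ρ a y = 0 := by
  rw [capDensity, hρ _ (Real.sqrt_le_iff.2 ⟨ha.le, by linarith⟩), zero_div]

theorem integral_capDensity_pos {ρ : ℝ → ℝ} {a : ℝ} (ha : 0 < a) (ha1 : a < 1)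
    (hc : Continuous ρ) (hρ : ∀ h ≤ a, ρ h = 0) (hρ' : ∀ h, a < h → h ≤ 1 → 0 < ρ h) :
    0 < ∫ y, capDensity ρ a y := by
  have hmax : ∀ y : ℝ × ℝ, 0 < max √(1 - (y.1 ^ 2 + y.2 ^ 2)) a := fun y => lt_max_of_lt_right ha
  refine Continuous.integral_pos_of_hasCompactSupport_nonneg_nonzero (x := 0) ?_ ?_ ?_ ?_
  · exact (hc.comp (by fun_prop)).div (by fun_prop) fun y => (hmax y).ne'
  · refine HasCompactSupport.intro (isCompact_closedBall (0 : ℝ × ℝ) 1) fun y hy => ?_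
    refine capDensity_eq_zero ha hρ ?_
    by_contra! h
    apply hy
    have h1 : |y.1| ≤ 1 := abs_le_one_iff_mul_self_le_one.2 (by nlinarith)
    have h2 : |y.2| ≤ 1 := abs_le_one_iff_mul_self_le_one.2 (by nlinarith)
    simpa [Prod.norm_def] using ⟨h1, h2⟩
  · intro y
    have h1 : √(1 - (y.1 ^ 2 + y.2 ^ 2)) ≤ 1 := Real.sqrt_le_iff.2 ⟨by norm_num, by nlinarith⟩
    refine div_nonneg ?_ (hmax y).le
    rcases le_or_gt √(1 - (y.1 ^ 2 + y.2 ^ 2)) a with h | h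
    · exact (hρ _ h).ge
    · exact (hρ' _ h h1).le
  · have := hρ' 1 ha1 le_rfl
    simp only [capDensity, Prod.fst_zero, Prod.snd_zero]
    norm_num
    exact ⟨this.ne', by positivity⟩

/-- Near a point of positive height with nonzero Jacobian, projection gives a chart. -/
theorem exists_chart {X Y Z : ℝ × ℝ → ℝ} (hX : ContDiff ℝ 1 X) (hY : ContDiff ℝ 1 Y)
    (hZ : Continuous Z) {q : ℝ × ℝ} (hq : 0 < Z q) (hJ : jacobian X Y q ≠ 0) {V : Set (ℝ × ℝ)}
    (hV : V ∈ 𝓝 q) :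
    ∃ U ⊆ V, IsOpen U ∧ q ∈ U ∧ InjOn (fun z => (X z, Y z)) U ∧
      (∀ z ∈ U, 0 < jacobian X Y q * jacobian X Y z) ∧ (∀ z ∈ U, 0 < Z z) ∧
      (fun z => (X z, Y z)) '' U ∈ 𝓝 (X q, Y q) := by
  have hst : HasStrictFDerivAt (fun z => (X z, Y z)) ((fderiv ℝ X q).prod (fderiv ℝ Y q)) q :=
    (hX.contDiffAt.hasStrictFDerivAt one_ne_zero).prodMk
      (hY.contDiffAt.hasStrictFDerivAt one_ne_zero)
  have hdet : ((fderiv ℝ X q).prod (fderiv ℝ Y q)).det ≠ 0 := by rwa [det_prod_fderiv]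
  set A := ((fderiv ℝ X q).prod (fderiv ℝ Y q)).toContinuousLinearEquivOfDetNeZero hdet with hA
  have hst' : HasStrictFDerivAt (fun z => (X z, Y z)) (A : ℝ × ℝ →L[ℝ] ℝ × ℝ) q := by
    simpa [hA] using hst
  set Φ := hst'.toOpenPartialHomeomorph _
  have hJc := continuous_jacobian hX hY
  set W : Set (ℝ × ℝ) :=
    interior V ∩ (Φ.source ∩ ({z | 0 < jacobian X Y q * jacobian X Y z} ∩ {z | 0 < Z z}))
  have hWo : IsOpen W := isOpen_interior.inter (Φ.open_source.inter
    ((isOpen_lt continuous_const (by fun_prop)).inter (isOpen_lt continuous_const hZ)))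
  have hqW : q ∈ W := ⟨mem_interior_iff_mem_nhds.2 hV,
    hst'.mem_toOpenPartialHomeomorph_source, mul_self_pos.2 hJ, hq⟩
  refine ⟨W, fun z hz => interior_subset hz.1, hWo, hqW, ?_, fun z hz => hz.2.2.1,
    fun z hz => hz.2.2.2, ?_⟩
  · exact Φ.injOn.mono fun z hz => hz.2.1
  · rw [← hst'.map_nhds_eq_of_equiv]
    exact image_mem_map (hWo.mem_nhds hqW)

theorem setIntegral_weighted_areaPullback {X Y Z : ℝ × ℝ → ℝ} (hX : Differentiable ℝ X)
    (hY : Differentiable ℝ Y) (hZ : Differentiable ℝ Z)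
    (hs : ∀ z, X z ^ 2 + Y z ^ 2 + Z z ^ 2 = 1) {ρ : ℝ → ℝ} {a σ : ℝ} (ha : 0 < a)
    (hρ : ∀ h ≤ a, ρ h = 0) {U : Set (ℝ × ℝ)} (hU : IsOpen U)
    (hinj : InjOn (fun z => (X z, Y z)) U) (hσ : ∀ z ∈ U, jacobian X Y z = σ * |jacobian X Y z|)
    (hpos : ∀ z ∈ U, 0 < Z z)
    (himage : ∀ y : ℝ × ℝ, y.1 ^ 2 + y.2 ^ 2 < 1 - a ^ 2 → y ∈ (fun z => (X z, Y z)) '' U) :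
    ∫ z in U, ρ (Z z) * areaPullback X Y Z z = σ * ∫ y, capDensity ρ a y := by
  have hd : ∀ z ∈ U, HasFDerivWithinAt (fun z => (X z, Y z))
      ((fderiv ℝ X z).prod (fderiv ℝ Y z)) U z := fun z _ =>
    ((hX z).hasFDerivAt.prodMk (hY z).hasFDerivAt).hasFDerivWithinAt
  have hcv := integral_image_eq_integral_abs_det_fderiv_smul volume hU.measurableSet hd hinj
    (capDensity ρ a)
  rw [setIntegral_eq_integral_of_forall_compl_eq_zero fun y hy => capDensity_eq_zero ha hρ
    (not_lt.1 fun h => hy (himage y h))] at hcv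
  rw [hcv, ← integral_const_mul]
  refine setIntegral_congr_fun hU.measurableSet fun z hz => ?_
  have hroot : √(1 - (X z ^ 2 + Y z ^ 2)) = Z z := by
    rw [← Real.sqrt_sq (hpos z hz).le]
    congr 1
    linarith [hs z]
  have harea := mul_areaPullback hX hY hZ hs z
  simp only [det_prod_fderiv, capDensity, hroot, smul_eq_mul]
  rcases le_or_gt (Z z) a with h | h
  · simp [hρ _ h]
  · have h0 := (hpos z hz).ne'
    rw [max_eq_left h.le, ← mul_assoc, ← hσ z hz, ← harea]
    field_simp

theorem sum_sign_jacobian_eq_zero {X Y Z : ℝ × ℝ → ℝ} (hX : ContDiff ℝ 3 X)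
    (hY : ContDiff ℝ 3 Y) (hZ : ContDiff ℝ 3 Z) (hs : ∀ z, X z ^ 2 + Y z ^ 2 + Z z ^ 2 = 1)
    (hX' : DoublyPeriodic X) (hY' : DoublyPeriodic Y) (hZ' : DoublyPeriodic Z)
    (himm : ∀ z, fderiv ℝ X z (0, 1) ^ 2 + fderiv ℝ Y z (0, 1) ^ 2 + fderiv ℝ Z z (0, 1) ^ 2 ≠ 0)
    {S : Finset (ℝ × ℝ)} (hS : ∀ q ∈ S, q ∈ Ioo (0 : ℝ) 1 ×ˢ Ioo (0 : ℝ) 1 ∧ Z q = 1 ∧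
      jacobian X Y q ≠ 0)
    (hS' : ∀ q ∈ Icc (0 : ℝ × ℝ) 1, Z q = 1 → q ∈ S) :
    ∑ q ∈ S, (if 0 < jacobian X Y q then (1 : ℤ) else -1) = 0 := by
  have cX := hX.of_le (show (1 : WithTop ℕ∞) ≤ 3 by norm_num)
  have cY := hY.of_le (show (1 : WithTop ℕ∞) ≤ 3 by norm_num)
  have cZ := hZ.of_le (show (1 : WithTop ℕ∞) ≤ 3 by norm_num)
  have dX := hX.differentiable (by norm_num)
  have dY := hY.differentiable (by norm_num)
  have dZ := hZ.differentiable (by norm_num)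
  obtain ⟨V, hV, hVd⟩ := S.finite_toSet.t2_separation
  have hchart : ∀ q : ℝ × ℝ, ∃ U : Set (ℝ × ℝ), q ∈ S → U ⊆ V q ∩ Ioo (0 : ℝ) 1 ×ˢ Ioo (0 : ℝ) 1 ∧
      IsOpen U ∧ q ∈ U ∧ InjOn (fun z => (X z, Y z)) U ∧
      (∀ z ∈ U, 0 < jacobian X Y q * jacobian X Y z) ∧ (∀ z ∈ U, 0 < Z z) ∧
      (fun z => (X z, Y z)) '' U ∈ 𝓝 (0 : ℝ × ℝ) := by
    intro q
    by_cases hq : q ∈ S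
    · obtain ⟨h1, h2, h3⟩ := hS q hq
      obtain ⟨U, h⟩ := exists_chart cX cY cZ.continuous (q := q) (by simp [h2]) h3
        (inter_mem ((hV q).2.mem_nhds (hV q).1) ((isOpen_Ioo.prod isOpen_Ioo).mem_nhds h1))
      have h4 := hs q
      rw [h2] at h4
      have h5 : X q = 0 := by nlinarith [sq_nonneg (X q), sq_nonneg (Y q)]
      have h6 : Y q = 0 := by nlinarith [sq_nonneg (X q), sq_nonneg (Y q)]
      rw [h5, h6] at h
      exact ⟨U, fun _ => h⟩
    · exact ⟨∅, fun h => absurd h hq⟩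
  choose U hU using hchart
  have hZ1 : ∀ z, Z z ≤ 1 := fun z => by nlinarith [hs z, sq_nonneg (X z), sq_nonneg (Y z)]
  have hopen : IsOpen (⋃ q ∈ S, U q) := isOpen_biUnion fun q hq => (hU q hq).2.1
  have hcpt : IsCompact (Icc (0 : ℝ × ℝ) 1 \ ⋃ q ∈ S, U q) := isCompact_Icc.diff hopen
  have hlow : ∀ᶠ a in 𝓝[<] (1 : ℝ), ∀ z ∈ Icc (0 : ℝ × ℝ) 1 \ ⋃ q ∈ S, U q, Z z ≤ a := by
    rcases (Icc (0 : ℝ × ℝ) 1 \ ⋃ q ∈ S, U q).eq_empty_or_nonempty with h | h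
    · simp [h]
    · obtain ⟨m, hm, hmax⟩ := hcpt.exists_isMaxOn h cZ.continuous.continuousOn
      have hlt : Z m < 1 := by
        refine lt_of_le_of_ne (hZ1 m) fun h1 => hm.2 ?_
        have hmS := hS' m hm.1 h1
        exact mem_biUnion hmS (hU m hmS).2.2.1
      filter_upwards [nhdsWithin_le_nhds (lt_mem_nhds hlt)] with a ha z hz
      exact (hmax hz).trans ha.le
  have hball : ∀ᶠ a in 𝓝[<] (1 : ℝ), ∀ q ∈ S, ∀ y : ℝ × ℝ, y.1 ^ 2 + y.2 ^ 2 < 1 - a ^ 2 →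
      y ∈ (fun z => (X z, Y z)) '' U q := by
    rw [Filter.eventually_all_finset]
    intro q hq
    obtain ⟨ε, hε, hsub⟩ := Metric.mem_nhds_iff.1 (hU q hq).2.2.2.2.2.2
    have hcont : Tendsto (fun a : ℝ => 1 - a ^ 2) (𝓝 1) (𝓝 (1 - 1 ^ 2)) :=
      Continuous.tendsto (by fun_prop) 1
    have := hcont.eventually_lt_const (u := ε ^ 2) (by norm_num; positivity)
    filter_upwards [nhdsWithin_le_nhds this] with a ha y hy
    apply hsub
    have h1 : |y.1| < ε := abs_lt_of_sq_lt_sq (by nlinarith [sq_nonneg y.2]) hε.le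
    have h2 : |y.2| < ε := abs_lt_of_sq_lt_sq (by nlinarith [sq_nonneg y.1]) hε.le
    simpa [Prod.norm_def] using ⟨h1, h2⟩
  obtain ⟨a, ⟨⟨hlow, hball⟩, ha⟩, ha1⟩ := (((hlow.and hball).and
    (nhdsWithin_le_nhds (lt_mem_nhds one_pos))).and self_mem_nhdsWithin).exists
  obtain ⟨b, hb, hb₁, hb₂⟩ := exists_cap_profile ha ha1
  set ρ : ℝ → ℝ := fun h => 1 - (1 - h ^ 2) * deriv b h + 2 * h * b h
  have hρ : ∀ h ≤ a, ρ h = 0 := hb₁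
  have hρ' : ∀ h, a < h → h ≤ 1 → 0 < ρ h := hb₂
  have hbc := hb.continuous
  have hbd := hb.continuous_deriv le_rfl
  have hρc : Continuous ρ := by fun_prop
  have hzero : ∫ z in Icc (0 : ℝ × ℝ) 1, ρ (Z z) * areaPullback X Y Z z = 0 :=
    integral_weighted_areaPullback_eq_zero hX hY hZ hs hX' hY' hZ' himm hb
  have hKpos := integral_capDensity_pos ha ha1 hρc hρ hρ'
  have hsub : ⋃ q ∈ S, U q ⊆ Icc (0 : ℝ × ℝ) 1 := by
    refine iUnion₂_subset fun q hq z hz => ?_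
    obtain ⟨⟨h1, h2⟩, h3, h4⟩ := ((hU q hq).1 hz).2
    exact ⟨⟨h1.le, h3.le⟩, ⟨h2.le, h4.le⟩⟩
  have hcont : Continuous fun z => ρ (Z z) * areaPullback X Y Z z := by
    have j1 := continuous_jacobian cX cY
    have j2 := continuous_jacobian cY cZ
    have j3 := continuous_jacobian cZ cX
    have := cX.continuous
    have := cY.continuous
    have := cZ.continuous
    unfold areaPullback
    fun_prop
  have hint : IntegrableOn (fun z => ρ (Z z) * areaPullback X Y Z z) (Icc (0 : ℝ × ℝ) 1) :=
    hcont.continuousOn.integrableOn_compact isCompact_Icc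
  rw [setIntegral_eq_of_subset_of_forall_sdiff_eq_zero measurableSet_Icc hsub
    (fun z hz => show ρ (Z z) * areaPullback X Y Z z = 0 by rw [hρ _ (hlow z hz), zero_mul]),
    integral_biUnion_finset S (fun q hq => (hU q hq).2.1.measurableSet)
    (fun q hq r hr hqr => (hVd hq hr hqr).mono (fun z hz => ((hU q hq).1 hz).1)
      fun z hz => ((hU r hr).1 hz).1)
    (fun q hq => hint.mono_set ((subset_biUnion_of_mem hq).trans hsub))] at hzero
  have hterm : ∀ q ∈ S, ∫ z in U q, ρ (Z z) * areaPullback X Y Z z =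
      ((if 0 < jacobian X Y q then (1 : ℤ) else -1 : ℤ) : ℝ) * ∫ y, capDensity ρ a y := by
    intro q hq
    obtain ⟨-, h1, -, h2, h3, h4, -⟩ := hU q hq
    refine setIntegral_weighted_areaPullback dX dY dZ hs ha hρ h1 h2 (fun z hz => ?_) h4
      (hball q hq)
    have := h3 z hz
    split_ifs with hpos
    · rw [abs_of_pos ((pos_iff_pos_of_mul_pos this).1 hpos)]; simp
    · rw [abs_of_neg (by nlinarith)]; simp
  rw [Finset.sum_congr rfl hterm, ← Finset.sum_mul] at hzero
  exact_mod_cast (mul_eq_zero.1 hzero).resolve_right hKpos.ne'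

end Localization

theorem exists_shift_fract_ne_zero (S : Finset ℝ) : ∃ c : ℝ, ∀ q ∈ S, Int.fract (q - c) ≠ 0 := by
  have hcount : (⋃ q ∈ S, range fun n : ℤ => q - n).Countable :=
    S.countable_toSet.biUnion fun q _ => countable_range _
  obtain ⟨c, hc⟩ := (hcount.dense_compl ℝ).nonempty
  refine ⟨c, fun q hq h => hc (mem_biUnion hq ⟨⌊q - c⌋, ?_⟩)⟩
  have := Int.self_sub_floor (q - c)
  rw [h] at this
  simp only
  linarith

theorem eq_of_fract_sub_eq {x y c : ℝ} (hx : x ∈ Ico (0 : ℝ) 1) (hy : y ∈ Ico (0 : ℝ) 1)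
    (h : Int.fract (x - c) = Int.fract (y - c)) : x = y := by
  obtain ⟨n, hn⟩ := Int.fract_eq_fract.1 h
  rw [← Int.fract_eq_self.2 hx, ← Int.fract_eq_self.2 hy]
  exact Int.fract_eq_fract.2 ⟨n, by linarith⟩

theorem DoublyPeriodic.add_int {E : Type*} {p : ℝ × ℝ → E} (hp : DoublyPeriodic p) (m n : ℤ)
    (s t : ℝ) : p (s + m, t + n) = p (s, t) := by
  have h1 : Function.Periodic (fun s => p (s, t + n)) 1 := fun s => (hp s (t + n)).1
  have h2 : Function.Periodic (fun t => p (s, t)) 1 := fun t => (hp s t).2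
  have h3 := h1.int_mul m s
  have h4 := h2.int_mul n t
  simp only [mul_one] at h3 h4
  rw [h3, h4]

/-- Translating a doubly periodic function moves a finite fibre off the boundary of the square. -/
theorem DoublyPeriodic.exists_shift_fibre {E : Type*} {p : ℝ × ℝ → E} (hp : DoublyPeriodic p)
    {x : E} {S : Finset (ℝ × ℝ)} (hS : ↑S ⊆ Ico (0 : ℝ) 1 ×ˢ Ico (0 : ℝ) 1)
    (hfib : ∀ q ∈ Ico (0 : ℝ) 1 ×ˢ Ico (0 : ℝ) 1, p q = x → q ∈ S) :
    ∃ (c : ℝ × ℝ) (τ : ℝ × ℝ → ℝ × ℝ), InjOn τ S ∧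
      (∀ q ∈ S, τ q ∈ Ioo (0 : ℝ) 1 ×ˢ Ioo (0 : ℝ) 1 ∧
        ∃ m n : ℤ, τ q + c = (q.1 + m, q.2 + n)) ∧
      ∀ z ∈ Icc (0 : ℝ × ℝ) 1, p (z + c) = x → z ∈ S.image τ := by
  obtain ⟨c, hc⟩ := exists_shift_fract_ne_zero (S.image Prod.fst)
  obtain ⟨d, hd⟩ := exists_shift_fract_ne_zero (S.image Prod.snd)
  have hc' : ∀ q ∈ S, Int.fract (q.1 - c) ≠ 0 := fun q hq => hc _ (Finset.mem_image_of_mem _ hq)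
  have hd' : ∀ q ∈ S, Int.fract (q.2 - d) ≠ 0 := fun q hq => hd _ (Finset.mem_image_of_mem _ hq)
  refine ⟨(c, d), fun q => (Int.fract (q.1 - c), Int.fract (q.2 - d)), ?_, ?_, ?_⟩
  · intro q hq r hr h
    rw [Prod.mk.injEq] at h
    exact Prod.ext (eq_of_fract_sub_eq (hS hq).1 (hS hr).1 h.1)
      (eq_of_fract_sub_eq (hS hq).2 (hS hr).2 h.2)
  · intro q hq
    refine ⟨⟨⟨(Int.fract_nonneg _).lt_of_ne' (hc' q hq), Int.fract_lt_one _⟩,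
      ⟨(Int.fract_nonneg _).lt_of_ne' (hd' q hq), Int.fract_lt_one _⟩⟩,
      -⌊q.1 - c⌋, -⌊q.2 - d⌋, ?_⟩
    ext <;> simp [← Int.self_sub_floor] <;> ring
  · intro z hz hzx
    set q : ℝ × ℝ := (Int.fract (z.1 + c), Int.fract (z.2 + d)) with hq
    have hqS : q ∈ S := by
      refine hfib q ⟨⟨Int.fract_nonneg _, Int.fract_lt_one _⟩,
        ⟨Int.fract_nonneg _, Int.fract_lt_one _⟩⟩ ?_
      rw [← hzx, ← hp.add_int ⌊z.1 + c⌋ ⌊z.2 + d⌋]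
      congr 1
      ext <;> simp
    have key : ∀ {a b : ℝ}, 0 ≤ a → a ≤ 1 → Int.fract (Int.fract (a + b) - b) ≠ 0 →
        Int.fract (Int.fract (a + b) - b) = a := by
      intro a b h0 h1 hne
      have e : Int.fract (Int.fract (a + b) - b) = Int.fract a :=
        Int.fract_eq_fract.2 ⟨-⌊a + b⌋, by
          rw [← Int.self_sub_floor (a + b)]; push_cast; ring⟩
      rw [e] at hne ⊢
      refine Int.fract_eq_self.2 ⟨h0, h1.lt_of_ne ?_⟩
      rintro rfl
      simp at hne
    refine Finset.mem_image.2 ⟨q, hqS, Prod.ext ?_ ?_⟩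
    · exact key hz.1.1 hz.2.1 (hc' q hqS)
    · exact key hz.1.2 hz.2.2 (hd' q hqS)

theorem exists_unit_orthogonal (x y z : ℝ) :
    ∃ a b c : ℝ, a ^ 2 + b ^ 2 + c ^ 2 = 1 ∧ x * a + y * b + z * c = 0 := by
  rcases eq_or_ne (x ^ 2 + y ^ 2) 0 with h0 | h0
  · have hx : x = 0 := by nlinarith [sq_nonneg x, sq_nonneg y]
    exact ⟨1, 0, 0, by norm_num, by simp [hx]⟩
  · have hr : √(x ^ 2 + y ^ 2) ^ 2 = x ^ 2 + y ^ 2 := Real.sq_sqrt (by positivity)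
    have hr0 : √(x ^ 2 + y ^ 2) ≠ 0 := fun h => h0 (by rw [← hr, h]; ring)
    refine ⟨-y / √(x ^ 2 + y ^ 2), x / √(x ^ 2 + y ^ 2), 0, ?_, by ring⟩
    rw [div_pow, div_pow, hr]
    field_simp
    ring

theorem sum_sq_orthonormal_frame {x y z a b c : ℝ} (hs : x ^ 2 + y ^ 2 + z ^ 2 = 1)
    (he : a ^ 2 + b ^ 2 + c ^ 2 = 1) (ho : x * a + y * b + z * c = 0) (u v w : ℝ) :
    (u * a + v * b + w * c) ^ 2 +
      (u * (y * c - z * b) + v * (z * a - x * c) + w * (x * b - y * a)) ^ 2 +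
      (u * x + v * y + w * z) ^ 2 = u ^ 2 + v ^ 2 + w ^ 2 := by
  grind

theorem pderiv1_eq_fderiv {f : ℝ × ℝ → EuclideanSpace ℝ (Fin 3)} (hf : Differentiable ℝ f)
    (q : ℝ × ℝ) : pderiv1 f q = fderiv ℝ f q (1, 0) :=
  (((hf q).hasFDerivAt.comp_hasDerivAt (f := fun u => (u, q.2)) q.1
    ((hasDerivAt_id q.1).prodMk (hasDerivAt_const q.1 q.2)))).deriv

theorem pderiv2_eq_fderiv {f : ℝ × ℝ → EuclideanSpace ℝ (Fin 3)} (hf : Differentiable ℝ f)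
    (q : ℝ × ℝ) : pderiv2 f q = fderiv ℝ f q (0, 1) :=
  (((hf q).hasFDerivAt.comp_hasDerivAt (f := fun u => (q.1, u)) q.2
    ((hasDerivAt_const q.2 q.1).prodMk (hasDerivAt_id q.2)))).deriv

/-- The component of `f (z + c)` along the vector `(u, v, w)`. -/
def component (f : ℝ × ℝ → EuclideanSpace ℝ (Fin 3)) (c : ℝ × ℝ) (u v w : ℝ) (z : ℝ × ℝ) : ℝ :=
  f (z + c) 0 * u + f (z + c) 1 * v + f (z + c) 2 * w

theorem contDiff_component {f : ℝ × ℝ → EuclideanSpace ℝ (Fin 3)} {n : WithTop ℕ∞}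
    (hf : ContDiff ℝ n f) (c : ℝ × ℝ) (u v w : ℝ) : ContDiff ℝ n (component f c u v w) := by
  have h : ∀ i, ContDiff ℝ n fun z => f (z + c) i := fun i =>
    (contDiff_euclidean.1 hf i).comp (contDiff_id.add contDiff_const)
  exact (((h 0).mul contDiff_const).add ((h 1).mul contDiff_const)).add ((h 2).mul contDiff_const)

theorem fderiv_component {f : ℝ × ℝ → EuclideanSpace ℝ (Fin 3)} (hf : Differentiable ℝ f)
    (c : ℝ × ℝ) (u v w : ℝ) (z e : ℝ × ℝ) :
    fderiv ℝ (component f c u v w) z e = fderiv ℝ f (z + c) e 0 * u +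
      fderiv ℝ f (z + c) e 1 * v + fderiv ℝ f (z + c) e 2 * w := by
  have h : ∀ i, HasFDerivAt (fun z => f (z + c) i)
      ((EuclideanSpace.proj i : EuclideanSpace ℝ (Fin 3) →L[ℝ] ℝ).comp (fderiv ℝ f (z + c))) z :=
    fun i => (EuclideanSpace.proj i : EuclideanSpace ℝ (Fin 3) →L[ℝ] ℝ).hasFDerivAt.comp z
      ((hasFDerivAt_comp_add_right c).2 (hf (z + c)).hasFDerivAt)
  have := ((((h 0).mul_const u).add ((h 1).mul_const v)).add ((h 2).mul_const w)).fderiv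
  rw [show component f c u v w = ((fun z => f (z + c) 0 * u) + fun z => f (z + c) 1 * v) +
    fun z => f (z + c) 2 * w from rfl, this]
  simp
  ring

theorem doublyPeriodic_component {f : ℝ × ℝ → EuclideanSpace ℝ (Fin 3)} (hf : DoublyPeriodic f)
    (c : ℝ × ℝ) (u v w : ℝ) : DoublyPeriodic (component f c u v w) := by
  obtain ⟨c₁, c₂⟩ := c
  intro s t
  have h1 : f ((s + 1, t) + (c₁, c₂)) = f ((s, t) + (c₁, c₂)) := by
    simpa [add_right_comm] using (hf (s + c₁) (t + c₂)).1
  have h2 : f ((s, t + 1) + (c₁, c₂)) = f ((s, t) + (c₁, c₂)) := by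
    simpa [add_right_comm] using (hf (s + c₁) (t + c₂)).2
  simp only [component, h1, h2, and_self]

/-- A smooth family of closed curves on `S²` all of which are immersions (equivalently, a
generic family with no Type 1 Reidemeister moves) has degree zero as a map `T² → S²`. -/
theorem degree_zero_of_family_of_immersed_curves
    (f : ℝ × ℝ → EuclideanSpace ℝ (Fin 3))
    (hsmooth : ContDiff ℝ (⊤ : ℕ∞) f)
    (hsphere : ∀ q, ‖f q‖ = 1)
    (hper1 : ∀ q : ℝ × ℝ, f (q.1 + 1, q.2) = f q)
    (hper2 : ∀ q : ℝ × ℝ, f (q.1, q.2 + 1) = f q)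
    (himm : ∀ t s : ℝ, deriv (fun u => f (t, u)) s ≠ 0)
    (d : ℤ) (hd : HasDegree f d) :
    d = 0 := by
  obtain ⟨x, S, hx, hS, hfib, hreg, rfl⟩ := hd
  have hf3 : ContDiff ℝ 3 f := contDiff_infty.1 hsmooth 3
  have hfd : Differentiable ℝ f := hf3.differentiable (by norm_num)
  have hf : DoublyPeriodic f := fun s t => ⟨hper1 (s, t), hper2 (s, t)⟩
  have hnorm : ∀ p : EuclideanSpace ℝ (Fin 3), p 0 ^ 2 + p 1 ^ 2 + p 2 ^ 2 = ‖p‖ ^ 2 := fun p => by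
    rw [EuclideanSpace.real_norm_sq_eq, Fin.sum_univ_three]
  have hx2 : x 0 ^ 2 + x 1 ^ 2 + x 2 ^ 2 = 1 := by rw [hnorm, hx]; norm_num
  have hf2 : ∀ q, f q 0 ^ 2 + f q 1 ^ 2 + f q 2 ^ 2 = 1 := fun q => by
    rw [hnorm, hsphere]; norm_num
  obtain ⟨u, v, w, hu, hux⟩ := exists_unit_orthogonal (x 0) (x 1) (x 2)
  have hframe := sum_sq_orthonormal_frame hx2 hu hux
  obtain ⟨c, τ, hinj, hτ, hfib'⟩ := hf.exists_shift_fibre hS fun q hq => (hfib q hq).1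
  set X := component f c u v w with hX
  set Y := component f c (x 1 * w - x 2 * v) (x 2 * u - x 0 * w) (x 0 * v - x 1 * u) with hY
  set Z := component f c (x 0) (x 1) (x 2) with hZ
  have hfx : ∀ q ∈ S, f q = x := fun q hq => (hfib q (hS hq)).2 hq
  have hshift : ∀ q ∈ S, f (τ q + c) = f q := by
    intro q hq
    obtain ⟨-, m, n, h⟩ := hτ q hq
    rw [h, hf.add_int]
  have hjac : ∀ q ∈ S, jacobian X Y (τ q) = frameDet f q := by
    intro q hq
    obtain ⟨-, m, n, h⟩ := hτ q hq
    have hD : fderiv ℝ f (τ q + c) = fderiv ℝ f q := by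
      have h1 : (fun z : ℝ × ℝ => f (z + ((m : ℝ), (n : ℝ)))) = f :=
        funext fun z => hf.add_int m n z.1 z.2
      have h2 := fderiv_comp_add_right (𝕜 := ℝ) (f := f) (x := q) ((m : ℝ), (n : ℝ))
      rw [h1] at h2
      rw [h2, h]
      rfl
    simp only [jacobian, hX, hY, fderiv_component hfd, hD, frameDet, pderiv1_eq_fderiv hfd,
      pderiv2_eq_fderiv hfd, Matrix.det_fin_three, hfx q hq]
    simp
    generalize fderiv ℝ f q (1, 0) = p
    generalize fderiv ℝ f q (0, 1) = r
    grind
  have hone : ∀ z, Z z = 1 → f (z + c) = x := by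
    intro z hz
    have h1 := hf2 (z + c)
    simp only [hZ, component] at hz
    have h2 : (f (z + c) 0 - x 0) ^ 2 + (f (z + c) 1 - x 1) ^ 2 + (f (z + c) 2 - x 2) ^ 2 = 0 := by
      linear_combination h1 + hx2 - 2 * hz
    have h3 : ‖f (z + c) - x‖ ^ 2 = 0 := by rw [← hnorm]; exact h2
    exact sub_eq_zero.1 (norm_eq_zero.1 (pow_eq_zero_iff two_ne_zero |>.1 h3))
  have main := sum_sign_jacobian_eq_zero (contDiff_component hf3 c u v w)
    (contDiff_component hf3 c (x 1 * w - x 2 * v) (x 2 * u - x 0 * w) (x 0 * v - x 1 * u))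
    (contDiff_component hf3 c (x 0) (x 1) (x 2))
    (fun z => (hframe _ _ _).trans (hf2 (z + c)))
    (doublyPeriodic_component hf _ _ _ _) (doublyPeriodic_component hf _ _ _ _)
    (doublyPeriodic_component hf _ _ _ _) (S := S.image τ) ?_ ?_ ?_
  · rw [Finset.sum_image hinj] at main
    rw [← main]
    exact Finset.sum_congr rfl fun q hq => by rw [← hjac q hq]
  · intro z
    simp only [fderiv_component hfd, hframe, hnorm]
    rw [← pderiv2_eq_fderiv hfd]
    exact pow_ne_zero 2 (norm_ne_zero_iff.2 (himm _ _))
  · intro z hz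
    obtain ⟨q, hq, rfl⟩ := Finset.mem_image.1 hz
    refine ⟨(hτ q hq).1, ?_, ?_⟩
    · simp only [component, hshift q hq, hfx q hq]
      linarith
    · exact (hjac q hq).trans_ne (hreg q hq)
  · exact fun z hz h => hfib' z hz (hone z h)
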